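/- Computation of the RLCT of K_3 with Dirichlet-type prior on a: if the prior factor on a near a = 0 is a^{α−1} with α > 0, then the largest pole of ζ(z) = ∫ K_3(v)^z a^{α−1} dv is at z = −λ with λ = (L−1)/2 + min(α/2, (L−1)/4), with order 2 if α = (L−1)/2 and 1 otherwise. -/

import Mathlib

open Finset MeasureTheory Filter

lemma geom_aux {E : Type*} [MeasurableSpace E] (ν : Measure E) (T : ℕ → Set E)
    (hT : Antitone T) (hm : ∀ k, MeasurableSet (T k)) (h0 : ⋂ k, T k = ∅) (c : ENNReal)
    (hc : ∀ k, ν (T (k+1) \ T (k+2)) = c * ν (T k \ T (k+1))) :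
    ν (T 0) = ν (T 0 \ T 1) * (1 - c)⁻¹ := by
  have hk : ∀ k, ν (T k \ T (k+1)) = c ^ k * ν (T 0 \ T 1) := by
    intro k
    induction k with
    | zero => simp
    | succ k ih => rw [hc, ih, pow_succ]; ring
  have hU : T 0 = ⋃ k, T k \ T (k+1) := by
    ext x
    simp only [Set.mem_iUnion]
    constructor
    · intro hx
      have hex : ∃ k, x ∉ T k := by
        by_contra hcon
        push Not at hcon
        have : x ∈ ⋂ k, T k := Set.mem_iInter.2 hcon
        rw [h0] at this
        exact this
      classical
      have h1 := Nat.find_spec hex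
      have h2 : Nat.find hex ≠ 0 := by
        intro h
        rw [h] at h1
        exact h1 hx
      obtain ⟨k, hk⟩ := Nat.exists_eq_succ_of_ne_zero h2
      refine ⟨k, ?_, ?_⟩
      · have := Nat.find_min hex (m := k) (by omega)
        simpa using this
      · rw [hk] at h1; exact h1
    · rintro ⟨k, hx, -⟩
      exact hT (Nat.zero_le k) hx
  have hd : Pairwise (Function.onFun Disjoint fun k => T k \ T (k+1)) := by
    have key : ∀ i j, i < j → Disjoint (T i \ T (i+1)) (T j \ T (j+1)) := by
      intro i j hij
      rw [Set.disjoint_left]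
      rintro x ⟨-, hx⟩ ⟨hy, -⟩
      exact hx (hT hij hy)
    intro i j hij
    rcases lt_or_gt_of_ne hij with h | h
    · exact key i j h
    · exact (key j i h).symm
  conv_lhs => rw [hU]
  rw [measure_iUnion hd (fun k => (hm k).diff (hm _))]
  rw [tsum_congr hk, ENNReal.tsum_mul_right, ENNReal.tsum_geometric, mul_comm]

lemma vol_scale (n : ℕ) (s t u : ℝ) (hs : 0 < s) (ht : 0 < t) (hu : 0 < u) :
    Measure.map (fun v : ℝ × (Fin n → ℝ) × (Fin n → ℝ) => (s * v.1, t • v.2.1, u • v.2.2)) volume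
      = ENNReal.ofReal ((s * t ^ n * u ^ n)⁻¹) • volume := by
  have e : (fun v : ℝ × (Fin n → ℝ) × (Fin n → ℝ) => (s * v.1, t • v.2.1, u • v.2.2))
    = Prod.map (fun x : ℝ => s • x) (Prod.map (fun x : Fin n → ℝ => t • x) (fun x : Fin n → ℝ => u • x)) := by
    ext v <;> simp
  have a1 := Measure.map_addHaar_smul (volume : Measure ℝ) hs.ne'
  have a2 := Measure.map_addHaar_smul (volume : Measure (Fin n → ℝ)) ht.ne'
  have a3 := Measure.map_addHaar_smul (volume : Measure (Fin n → ℝ)) hu.ne'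
  have ee : ∀ w : ℝ, 0 < w → |(w ^ n)⁻¹| = (w ^ n)⁻¹ := fun w hw => abs_of_pos (by positivity)
  simp only [Module.finrank_fin_fun, Module.finrank_self, pow_one, ee t ht, ee u hu, abs_of_pos (inv_pos.2 hs)] at a1 a2 a3
  change Measure.map _ ((volume : Measure ℝ).prod ((volume : Measure (Fin n → ℝ)).prod (volume : Measure (Fin n → ℝ)))) = _ • ((volume : Measure ℝ).prod ((volume : Measure (Fin n → ℝ)).prod (volume : Measure (Fin n → ℝ))))
  rw [e, ← Measure.map_prod_map _ _ (by fun_prop) (by fun_prop), ← Measure.map_prod_map _ _ (by fun_prop) (by fun_prop)]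
  erw [a1, a2, a3]
  have : SFinite (ENNReal.ofReal (u ^ n)⁻¹ • (volume : Measure (Fin n → ℝ))) := inferInstance
  simp only [Measure.prod_smul_left, Measure.prod_smul_right, smul_smul]
  congr 1
  rw [← ENNReal.ofReal_mul (by positivity), ← ENNReal.ofReal_mul (by positivity)]
  congr 1
  field_simp

lemma scale_aux (n : ℕ) (s t u q : ℝ) (hs : 0 < s) (ht : 0 < t) (hu : 0 < u) (hq : 0 < q)
    (f : ℝ × (Fin n → ℝ) × (Fin n → ℝ) → ℝ) (hf : Measurable f)
    (A A' : Set (ℝ × (Fin n → ℝ) × (Fin n → ℝ))) (hA : MeasurableSet A) (hA' : MeasurableSet A')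
    (h : ∀ v, (s * v.1, t • v.2.1, u • v.2.2) ∈ A' ↔ v ∈ A)
    (hfv : ∀ v ∈ A, f (s * v.1, t • v.2.1, u • v.2.2) = q * f v) :
    ∫⁻ v in A', ENNReal.ofReal (f v) = ENNReal.ofReal (q * (s * t ^ n * u ^ n)) *
      ∫⁻ v in A, ENNReal.ofReal (f v) := by
  set ψ := (fun v : ℝ × (Fin n → ℝ) × (Fin n → ℝ) => (s * v.1, t • v.2.1, u • v.2.2)) with hψ
  have hψm : Measurable ψ := by fun_prop
  have hpre : ψ ⁻¹' A' = A := by ext v; exact h v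
  have hpos : 0 < s * t ^ n * u ^ n := by positivity
  have h1 : ENNReal.ofReal ((s * t ^ n * u ^ n)⁻¹) * ∫⁻ v in A', ENNReal.ofReal (f v)
      = ENNReal.ofReal q * ∫⁻ v in A, ENNReal.ofReal (f v) := by
    have : ∫⁻ v in A', ENNReal.ofReal (f v) ∂(Measure.map ψ volume)
       = ENNReal.ofReal ((s * t ^ n * u ^ n)⁻¹) * ∫⁻ v in A', ENNReal.ofReal (f v) := by
      rw [hψ, vol_scale n s t u hs ht hu, Measure.restrict_smul, lintegral_smul_measure, smul_eq_mul]
    rw [← this, setLIntegral_map hA' (by fun_prop) hψm, hpre, ← lintegral_const_mul _ (by fun_prop)]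
    refine setLIntegral_congr_fun hA ?_
    intro v hv
    simp only
    rw [hfv v hv, ENNReal.ofReal_mul hq.le]
  rw [mul_comm q, ENNReal.ofReal_mul hpos.le, mul_assoc, ← h1, ← mul_assoc, ← ENNReal.ofReal_mul hpos.le,
    mul_inv_cancel₀ hpos.ne']
  simp

/-- continuity lemma -/
lemma cont_aux {E : Type*} [MeasurableSpace E] (μ : Measure E) (k g : E → ℝ) (κ M : ℝ) (hκ : 0 < κ)
    (hk : Measurable k) (hg : Measurable g) (hgi : Integrable g μ) (hg0 : ∀ᵐ v ∂μ, 0 < g v)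
    (hκk : ∀ᵐ v ∂μ, κ ≤ k v) (hkM : ∀ᵐ v ∂μ, k v ≤ M) :
    (∀ z : ℝ, Integrable (fun v => k v ^ z * g v) μ) ∧
    Continuous (fun z : ℝ => ∫ v, k v ^ z * g v ∂μ) ∧
    (∀ z : ℝ, 0 ≤ ∫ v, k v ^ z * g v ∂μ) ∧
    (μ ≠ 0 → ∀ z : ℝ, 0 < ∫ v, k v ^ z * g v ∂μ) := by
  have hnn : ∀ z : ℝ, ∀ᵐ v ∂μ, 0 < k v ^ z * g v := by
    intro z
    filter_upwards [hg0, hκk] with v h1 h2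
    have := hκ.trans_le h2
    positivity
  have hI : ∀ z : ℝ, Integrable (fun v => k v ^ z * g v) μ := by
    intro z
    refine Integrable.mono' (hgi.const_mul (κ ^ z + M ^ z)) (by fun_prop) ?_
    filter_upwards [hg0, hκk, hkM, hnn z] with v h1 h2 h3 h4
    rw [Real.norm_of_nonneg h4.le]
    have hkp := hκ.trans_le h2
    have hM := hkp.trans_le h3
    gcongr
    rcases le_total 0 z with hz | hz
    · have := Real.rpow_le_rpow hkp.le h3 hz
      have : 0 < κ ^ z := by positivity
      linarith
    · have := Real.rpow_le_rpow_of_nonpos hκ h2 hz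
      have : 0 < M ^ z := by positivity
      linarith
  refine ⟨hI, ?_, ?_, ?_⟩
  · rw [continuous_iff_continuousAt]
    intro z0
    refine continuousAt_of_dominated (bound := fun v => k v ^ (z0-1) * g v + k v ^ (z0+1) * g v) ?_ ?_ ((hI _).add (hI _)) ?_
    · exact Eventually.of_forall fun z => (hI z).aestronglyMeasurable
    · filter_upwards [Ioo_mem_nhds (show z0 - 1 < z0 by linarith) (show z0 < z0 + 1 by linarith)] with z hz
      filter_upwards [hg0, hκk, hnn z] with v h1 h2 h4
      rw [Real.norm_of_nonneg h4.le, ← add_mul]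
      have hkp := hκ.trans_le h2
      gcongr
      have p1 : 0 < k v ^ (z0-1) := by positivity
      have p2 : 0 < k v ^ (z0+1) := by positivity
      rcases le_total 1 (k v) with hz' | hz'
      · have := Real.rpow_le_rpow_of_exponent_le hz' hz.2.le
        linarith
      · have := Real.rpow_le_rpow_of_exponent_ge hkp hz' hz.1.le
        linarith
    · filter_upwards [hκk] with v h2
      have hkp := hκ.trans_le h2
      exact (Real.continuousAt_const_rpow hkp.ne').mul continuousAt_const
  · intro z
    exact integral_nonneg_of_ae ((hnn z).mono fun v h => h.le)
  · intro hμ z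
    rw [integral_pos_iff_support_of_nonneg_ae ((hnn z).mono fun v h => h.le) (hI z)]
    have : μ (Function.support fun v => k v ^ z * g v)ᶜ = 0 := by
      refine measure_mono_null ?_ (ae_iff.1 (hnn z))
      intro v hv
      simp only [Set.mem_compl_iff, Function.mem_support, not_not] at hv
      simp [hv]
    by_contra hcon
    apply hμ
    rw [← Measure.measure_univ_eq_zero, ← Set.union_compl_self (Function.support fun v => k v ^ z * g v)]
    exact measure_union_null (by simpa using hcon) this

lemma lim_aux (k : ℝ) (hk : 0 < k) (lam : ℝ) :
    Tendsto (fun z : ℝ => (z + lam) / (1 - (1/2:ℝ) ^ (k * (z + lam)))) (nhdsWithin (-lam) (Set.Ioi (-lam)))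
      (nhds (1 / (k * Real.log 2))) := by
  have hl : 0 < Real.log 2 := Real.log_pos (by norm_num)
  have hd : HasDerivAt (fun z : ℝ => 1 - (1/2:ℝ) ^ (k * (z + lam))) (k * Real.log 2) (-lam) := by
    have h1 : HasDerivAt (fun z : ℝ => k * (z + lam)) k (-lam) := by
      simpa using ((hasDerivAt_id (-lam)).add_const lam).const_mul k
    have h2 := (h1.const_rpow (a := (1/2:ℝ)) (by norm_num)).const_sub 1
    refine h2.congr_deriv ?_
    rw [one_div, Real.log_inv, neg_add_cancel, mul_zero, Real.rpow_zero]
    ring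
  have := (hasDerivAt_iff_tendsto_slope.1 hd).mono_left (nhdsWithin_mono _ (fun x (hx : x ∈ Set.Ioi (-lam)) => (ne_of_gt hx : x ∈ ({-lam}ᶜ : Set ℝ))))
  have h3 := this.inv₀ (by positivity)
  rw [one_div (k * Real.log 2)]
  refine h3.congr fun z => ?_
  simp [slope_def_field]

def cubeK (n : ℕ) (t : ℝ) : Set (Fin n → ℝ) := Set.pi Set.univ (fun _ => Set.Ioc 0 t)

lemma mem_cubeK {n : ℕ} {t : ℝ} {x : Fin n → ℝ} : x ∈ cubeK n t ↔ ∀ i, 0 < x i ∧ x i ≤ t := by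
  simp [cubeK]

lemma meas_cubeK (n : ℕ) (t : ℝ) : MeasurableSet (cubeK n t) :=
  MeasurableSet.univ_pi fun _ => measurableSet_Ioc

lemma mono_cubeK (n : ℕ) {s t : ℝ} (h : s ≤ t) : cubeK n s ⊆ cubeK n t := by
  intro x hx
  rw [mem_cubeK] at *
  exact fun i => ⟨(hx i).1, (hx i).2.trans h⟩

def KK (n : ℕ) (v : ℝ × (Fin n → ℝ) × (Fin n → ℝ)) : ℝ :=
  ∑ ℓ, v.2.1 ℓ ^ 2 + v.1 ^ 2 * ∑ ℓ, v.2.2 ℓ ^ 4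

lemma meas_KK (n : ℕ) : Measurable (KK n) := by unfold KK; fun_prop

lemma scale_mem (w x ε : ℝ) (hw : 0 < w) (k : ℕ) :
    (0 < w * x ∧ w * x ≤ ε * w ^ (k+1)) ↔ (0 < x ∧ x ≤ ε * w ^ k) := by
  rw [mul_pos_iff_of_pos_left hw, pow_succ, ← mul_assoc, mul_comm _ w, mul_le_mul_iff_right₀ hw]

lemma scale_cube {n : ℕ} (w ε : ℝ) (x : Fin n → ℝ) (hw : 0 < w) (k : ℕ) :
    w • x ∈ cubeK n (ε * w ^ (k+1)) ↔ x ∈ cubeK n (ε * w ^ k) := by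
  simp only [mem_cubeK, Pi.smul_apply, smul_eq_mul, scale_mem w _ ε hw k]

lemma exists_small (ε x w : ℝ) (hx : 0 < x) (hw : 0 < w) (hw1 : w < 1) (hε : 0 < ε) :
    ∃ k : ℕ, ε * w ^ k < x := by
  obtain ⟨k, hk⟩ := exists_pow_lt_of_lt_one (show 0 < x / ε by positivity) hw1
  refine ⟨k, ?_⟩
  rwa [lt_div_iff₀ hε, mul_comm] at hk

def T1 (n : ℕ) (ε : ℝ) (k : ℕ) : Set (ℝ × (Fin n → ℝ) × (Fin n → ℝ)) :=
  Set.Ioc 0 (ε * (1/2) ^ k) ×ˢ (cubeK n (ε * (1/2) ^ k) ×ˢ cubeK n ε)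

def T2 (n : ℕ) (ε : ℝ) (k : ℕ) : Set (ℝ × (Fin n → ℝ) × (Fin n → ℝ)) :=
  Set.Ioc (ε / 2) ε ×ˢ (cubeK n (ε * (1/4) ^ k) ×ˢ cubeK n (ε * (1/2) ^ k))

def R1 (n : ℕ) (ε : ℝ) : Set (ℝ × (Fin n → ℝ) × (Fin n → ℝ)) :=
  Set.Ioc 0 (ε / 2) ×ˢ ((cubeK n ε \ cubeK n (ε / 2)) ×ˢ cubeK n ε)

lemma meas_T1 (n : ℕ) (ε : ℝ) (k : ℕ) : MeasurableSet (T1 n ε k) :=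
  measurableSet_Ioc.prod ((meas_cubeK _ _).prod (meas_cubeK _ _))

lemma meas_T2 (n : ℕ) (ε : ℝ) (k : ℕ) : MeasurableSet (T2 n ε k) :=
  measurableSet_Ioc.prod ((meas_cubeK _ _).prod (meas_cubeK _ _))

lemma meas_R1 (n : ℕ) (ε : ℝ) : MeasurableSet (R1 n ε) :=
  measurableSet_Ioc.prod (((meas_cubeK _ _).diff (meas_cubeK _ _)).prod (meas_cubeK _ _))

lemma anti_T1 (n : ℕ) (ε : ℝ) (hε : 0 < ε) : Antitone (T1 n ε) := by
  intro i j hij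
  have h : ε * (1/2 : ℝ) ^ j ≤ ε * (1/2) ^ i :=
    mul_le_mul_of_nonneg_left (pow_le_pow_of_le_one (by norm_num) (by norm_num) hij) hε.le
  exact Set.prod_mono (Set.Ioc_subset_Ioc_right h) (Set.prod_mono (mono_cubeK n h) le_rfl)

lemma anti_T2 (n : ℕ) (ε : ℝ) (hε : 0 < ε) : Antitone (T2 n ε) := by
  intro i j hij
  have h : ε * (1/2 : ℝ) ^ j ≤ ε * (1/2) ^ i :=
    mul_le_mul_of_nonneg_left (pow_le_pow_of_le_one (by norm_num) (by norm_num) hij) hε.le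
  have h' : ε * (1/4 : ℝ) ^ j ≤ ε * (1/4) ^ i :=
    mul_le_mul_of_nonneg_left (pow_le_pow_of_le_one (by norm_num) (by norm_num) hij) hε.le
  exact Set.prod_mono le_rfl (Set.prod_mono (mono_cubeK n h') (mono_cubeK n h))

lemma inter_T1 (n : ℕ) (ε : ℝ) (hε : 0 < ε) : ⋂ k, T1 n ε k = ∅ := by
  rw [Set.eq_empty_iff_forall_notMem]
  intro v hv
  rw [Set.mem_iInter] at hv
  obtain ⟨k, hk⟩ := exists_small ε v.1 (1/2) (hv 0).1.1 (by norm_num) (by norm_num) hε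
  exact absurd (hv k).1.2 (not_le.2 hk)

lemma inter_T2 (n : ℕ) (hn : 0 < n) (ε : ℝ) (hε : 0 < ε) : ⋂ k, T2 n ε k = ∅ := by
  rw [Set.eq_empty_iff_forall_notMem]
  intro v hv
  rw [Set.mem_iInter] at hv
  obtain ⟨k, hk⟩ := exists_small ε (v.2.2 ⟨0, hn⟩) (1/2) (mem_cubeK.1 (hv 0).2.2 _).1 (by norm_num) (by norm_num) hε
  exact absurd (mem_cubeK.1 (hv k).2.2 ⟨0, hn⟩).2 (not_le.2 hk)

lemma scale_T1 (n : ℕ) (ε : ℝ) (k : ℕ) (v : ℝ × (Fin n → ℝ) × (Fin n → ℝ)) :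
    ((1/2 : ℝ) * v.1, (1/2 : ℝ) • v.2.1, (1 : ℝ) • v.2.2) ∈ T1 n ε (k+1) ↔ v ∈ T1 n ε k := by
  simp only [T1, Set.mem_prod, Set.mem_Ioc, scale_mem (1/2) _ ε (by norm_num) k,
    scale_cube (1/2) ε _ (by norm_num) k, one_smul]

lemma scale_T2 (n : ℕ) (ε : ℝ) (k : ℕ) (v : ℝ × (Fin n → ℝ) × (Fin n → ℝ)) :
    ((1 : ℝ) * v.1, (1/4 : ℝ) • v.2.1, (1/2 : ℝ) • v.2.2) ∈ T2 n ε (k+1) ↔ v ∈ T2 n ε k := by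
  simp only [T2, Set.mem_prod, scale_cube (1/4) ε _ (by norm_num) k,
    scale_cube (1/2) ε _ (by norm_num) k, one_mul]

lemma T1_sub (n : ℕ) (ε : ℝ) (hε : 0 < ε) (k : ℕ) : T1 n ε k ⊆ T1 n ε 0 := anti_T1 n ε hε (Nat.zero_le k)

lemma T2_sub (n : ℕ) (ε : ℝ) (hε : 0 < ε) (k : ℕ) : T2 n ε k ⊆ T1 n ε 0 := by
  refine (anti_T2 n ε hε (Nat.zero_le k)).trans ?_
  simp only [T1, T2, pow_zero, mul_one]
  exact Set.prod_mono (Set.Ioc_subset_Ioc_left (by positivity)) le_rfl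

lemma R1_sub (n : ℕ) (ε : ℝ) (hε : 0 < ε) : R1 n ε ⊆ T1 n ε 0 := by
  simp only [T1, R1, pow_zero, mul_one]
  exact Set.prod_mono (Set.Ioc_subset_Ioc_right (by linarith)) (Set.prod_mono Set.sdiff_subset le_rfl)

lemma T1_diff (n : ℕ) (ε : ℝ) (hε : 0 < ε) : T1 n ε 0 \ T1 n ε 1 = T2 n ε 0 ∪ R1 n ε := by
  ext v
  have hh : v.2.1 ∈ cubeK n (ε/2) → v.2.1 ∈ cubeK n ε := fun h => mono_cubeK n (by linarith) h
  have e : ε * (1/2) = ε / 2 := by ring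
  simp only [T1, T2, R1, pow_zero, mul_one, pow_one, Set.mem_sdiff, Set.mem_union, Set.mem_prod, Set.mem_Ioc, e]
  have h3 : ε / 2 < v.1 ↔ ¬ v.1 ≤ ε / 2 := not_le.symm
  have h4 : v.1 ≤ ε / 2 → v.1 ≤ ε := fun h => by linarith
  have h5 : ¬ v.1 ≤ ε / 2 → 0 < v.1 := fun h => by linarith
  rw [h3]
  tauto

lemma T1_disj (n : ℕ) (ε : ℝ) : Disjoint (T2 n ε 0) (R1 n ε) := by
  rw [Set.disjoint_left]
  intro v h1 h2
  exact absurd h1.1.1 (not_lt.2 h2.1.2)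

lemma pos_T1 (n : ℕ) (hn : 0 < n) (ε : ℝ) (v : ℝ × (Fin n → ℝ) × (Fin n → ℝ)) (hv : v ∈ T1 n ε 0) :
    0 < v.1 ∧ 0 < KK n v := by
  refine ⟨hv.1.1, ?_⟩
  have : 0 < ∑ ℓ, v.2.1 ℓ ^ 2 :=
    Finset.sum_pos (fun i _ => by have := (mem_cubeK.1 hv.2.1 i).1; positivity) ⟨⟨0, hn⟩, Finset.mem_univ _⟩
  unfold KK
  positivity

lemma KK_le (n : ℕ) (ε : ℝ) (v : ℝ × (Fin n → ℝ) × (Fin n → ℝ)) (hv : v ∈ T1 n ε 0) :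
    KK n v ≤ n * ε ^ 2 + ε ^ 2 * (n * ε ^ 4) := by
  obtain ⟨h1, h2, h3⟩ := hv
  simp only [pow_zero, mul_one, mem_cubeK] at h1 h2 h3
  have hε : 0 < ε := h1.1.trans_le h1.2
  unfold KK
  have a1 : ∑ ℓ, v.2.1 ℓ ^ 2 ≤ n * ε ^ 2 := by
    calc _ ≤ ∑ ℓ : Fin n, ε ^ 2 := Finset.sum_le_sum fun i _ => pow_le_pow_left₀ (h2 i).1.le (h2 i).2 2
      _ = _ := by simp
  have a2 : ∑ ℓ, v.2.2 ℓ ^ 4 ≤ n * ε ^ 4 := by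
    calc _ ≤ ∑ ℓ : Fin n, ε ^ 4 := Finset.sum_le_sum fun i _ => pow_le_pow_left₀ (h3 i).1.le (h3 i).2 4
      _ = _ := by simp
  have a3 : v.1 ^ 2 ≤ ε ^ 2 := pow_le_pow_left₀ h1.1.le h1.2 2
  gcongr

lemma notMem_cubeK {n : ℕ} {s t : ℝ} {x : Fin n → ℝ} (h : x ∈ cubeK n t) (h' : x ∉ cubeK n s) :
    ∃ i, s < x i := by
  rw [mem_cubeK] at h h'
  push Not at h'
  obtain ⟨i, hi⟩ := h'
  exact ⟨i, hi (h i).1⟩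

lemma KK_ge_delta (n : ℕ) (s : ℝ) (hs : 0 ≤ s) (v : ℝ × (Fin n → ℝ) × (Fin n → ℝ)) (i : Fin n)
    (hi : s < v.2.1 i) : s ^ 2 ≤ KK n v := by
  have h1 : v.2.1 i ^ 2 ≤ ∑ ℓ, v.2.1 ℓ ^ 2 :=
    Finset.single_le_sum (f := fun ℓ => v.2.1 ℓ ^ 2) (fun j _ => by positivity) (Finset.mem_univ i)
  have h2 : s ^ 2 ≤ v.2.1 i ^ 2 := pow_le_pow_left₀ hs hi.le 2
  have h3 : 0 ≤ v.1 ^ 2 * ∑ ℓ, v.2.2 ℓ ^ 4 := by positivity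
  unfold KK
  linarith

lemma KK_ge_beta (n : ℕ) (s r : ℝ) (hs : 0 ≤ s) (hr : 0 ≤ r) (v : ℝ × (Fin n → ℝ) × (Fin n → ℝ)) (i : Fin n)
    (hi : s < v.2.2 i) (ha : r < v.1) : r ^ 2 * s ^ 4 ≤ KK n v := by
  have h1 : v.2.2 i ^ 4 ≤ ∑ ℓ, v.2.2 ℓ ^ 4 :=
    Finset.single_le_sum (f := fun ℓ => v.2.2 ℓ ^ 4) (fun j _ => by positivity) (Finset.mem_univ i)
  have h2 : s ^ 4 ≤ v.2.2 i ^ 4 := pow_le_pow_left₀ hs hi.le 4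
  have h4 : r ^ 2 ≤ v.1 ^ 2 := pow_le_pow_left₀ hr ha.le 2
  have h3 : r ^ 2 * s ^ 4 ≤ v.1 ^ 2 * ∑ ℓ, v.2.2 ℓ ^ 4 := by
    gcongr
    linarith
  have h5 : 0 ≤ ∑ ℓ, v.2.1 ℓ ^ 2 := by positivity
  unfold KK
  linarith

noncomputable def fK (n : ℕ) (α z : ℝ) (v : ℝ × (Fin n → ℝ) × (Fin n → ℝ)) : ℝ := KK n v ^ z * v.1 ^ (α - 1)

lemma meas_fK (n : ℕ) (α z : ℝ) : Measurable (fK n α z) := by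
  have := meas_KK n
  unfold fK
  fun_prop

lemma volume_cubeK (n : ℕ) (t : ℝ) : volume (cubeK n t) = ENNReal.ofReal t ^ n := by
  simp [cubeK, Real.volume_pi_Ioc, volume_pi_pi]

lemma integrable_prior (n : ℕ) (ε : ℝ) (hε : 0 < ε) (α : ℝ) (hα : 0 < α) :
    IntegrableOn (fun v : ℝ × (Fin n → ℝ) × (Fin n → ℝ) => v.1 ^ (α - 1)) (T1 n ε 0) := by
  have h1 : IntegrableOn (fun a : ℝ => a ^ (α - 1)) (Set.Ioc 0 (ε * (1/2) ^ 0)) := by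
    have := intervalIntegral.intervalIntegrable_rpow' (a := 0) (b := ε * (1/2)^0) (r := α - 1) (by linarith)
    rwa [intervalIntegrable_iff_integrableOn_Ioc_of_le (by positivity)] at this
  have h2 : IntegrableOn (fun _ : (Fin n → ℝ) × (Fin n → ℝ) => (1 : ℝ)) (cubeK n (ε * (1/2) ^ 0) ×ˢ cubeK n ε) := by
    rw [integrableOn_const_iff]
    right
    rw [Measure.volume_eq_prod, Measure.prod_prod, volume_cubeK, volume_cubeK]
    exact ENNReal.mul_lt_top (by simp) (by simp)
  have h3 := Integrable.mul_prod h1 h2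
  simp only [mul_one] at h3
  unfold IntegrableOn T1
  rw [Measure.volume_eq_prod, ← Measure.prod_restrict]
  exact h3

/-- integral on a region where K is bounded below -/
lemma region (n : ℕ) (hn : 0 < n) (ε : ℝ) (hε : 0 < ε) (α : ℝ) (hα : 0 < α)
    (A : Set (ℝ × (Fin n → ℝ) × (Fin n → ℝ))) (hA : MeasurableSet A) (hAs : A ⊆ T1 n ε 0) (κ : ℝ) (hκ : 0 < κ)
    (hb : ∀ v ∈ A, κ ≤ KK n v) :
    ∃ r : ℝ → ℝ, Continuous r ∧ (∀ z, 0 ≤ r z) ∧ (volume A ≠ 0 → ∀ z, 0 < r z) ∧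
      ∀ z, ∫⁻ v in A, ENNReal.ofReal (fK n α z v) = ENNReal.ofReal (r z) := by
  obtain ⟨h1, h2, h3, h4⟩ := cont_aux (volume.restrict A) (KK n) (fun v => v.1 ^ (α - 1)) κ
    (n * ε ^ 2 + ε ^ 2 * (n * ε ^ 4)) hκ (meas_KK n) (by fun_prop) ((integrable_prior n ε hε α hα).mono_set hAs)
    ((ae_restrict_iff' hA).2 (Eventually.of_forall fun v hv => by
      have := (pos_T1 n hn ε v (hAs hv)).1
      positivity))
    ((ae_restrict_iff' hA).2 (Eventually.of_forall hb))
    ((ae_restrict_iff' hA).2 (Eventually.of_forall fun v hv => KK_le n ε v (hAs hv)))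
  refine ⟨_, h2, h3, fun h => h4 (by rwa [Ne, Measure.restrict_eq_zero]), fun z => ?_⟩
  rw [ofReal_integral_eq_lintegral_ofReal (h1 z)]
  · rfl
  · refine (ae_restrict_iff' hA).2 (Eventually.of_forall fun v hv => ?_)
    obtain ⟨p1, p2⟩ := pos_T1 n hn ε v (hAs hv)
    simp only [Pi.zero_apply]
    positivity

lemma geom_fK (n : ℕ) (α z s t u q c : ℝ) (hs : 0 < s) (ht : 0 < t) (hu : 0 < u) (hq : 0 < q)
    (T : ℕ → Set (ℝ × (Fin n → ℝ) × (Fin n → ℝ)))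
    (hT : Antitone T) (hm : ∀ k, MeasurableSet (T k)) (h0 : ⋂ k, T k = ∅)
    (hsc : ∀ k v, (s * v.1, t • v.2.1, u • v.2.2) ∈ T (k+1) ↔ v ∈ T k)
    (hfv : ∀ v ∈ T 0, fK n α z (s * v.1, t • v.2.1, u • v.2.2) = q * fK n α z v)
    (hc : c = q * (s * t ^ n * u ^ n)) :
    ∫⁻ v in T 0, ENNReal.ofReal (fK n α z v) =
      (∫⁻ v in T 0 \ T 1, ENNReal.ofReal (fK n α z v)) * (1 - ENNReal.ofReal c)⁻¹ := by
  have := geom_aux (volume.withDensity fun v => ENNReal.ofReal (fK n α z v)) T hT hm h0 (ENNReal.ofReal c) ?_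
  · rwa [withDensity_apply _ (hm 0), withDensity_apply _ ((hm 0).diff (hm 1))] at this
  · intro k
    rw [withDensity_apply _ ((hm _).diff (hm _)), withDensity_apply _ ((hm _).diff (hm _)), hc]
    refine scale_aux n s t u q hs ht hu hq _ (meas_fK n α z) _ _ ((hm _).diff (hm _)) ((hm _).diff (hm _)) ?_ ?_
    · intro v
      rw [Set.mem_sdiff, Set.mem_sdiff, hsc, hsc]
    · intro v hv
      exact hfv v (hT (Nat.zero_le k) hv.1)

lemma half_nat (x : ℝ) (k : ℕ) : ((1/2 : ℝ) ^ k) ^ x = (1/2 : ℝ) ^ (k * x) := by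
  rw [← Real.rpow_natCast, ← Real.rpow_mul (by norm_num)]

lemma step1 (n : ℕ) (hn : 0 < n) (ε : ℝ) (hε : 0 < ε) (α z : ℝ) :
    ∫⁻ v in T1 n ε 0, ENNReal.ofReal (fK n α z v) =
      ((∫⁻ v in T2 n ε 0, ENNReal.ofReal (fK n α z v)) + ∫⁻ v in R1 n ε, ENNReal.ofReal (fK n α z v)) *
        (1 - ENNReal.ofReal ((1/2 : ℝ) ^ (2 * (z + (n + α) / 2))))⁻¹ := by
  rw [← lintegral_union (meas_R1 n ε) (T1_disj n ε), ← T1_diff n ε hε]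
  refine geom_fK n α z (1/2) (1/2) 1 ((1/2 : ℝ) ^ (2 * z) * (1/2 : ℝ) ^ (α - 1)) _ (by norm_num) (by norm_num)
    (by norm_num) (by positivity) _ (anti_T1 n ε hε) (meas_T1 n ε) (inter_T1 n ε hε) (scale_T1 n ε) ?_ ?_
  · intro v hv
    obtain ⟨p1, p2⟩ := pos_T1 n hn ε v hv
    have e : KK n ((1/2 : ℝ) * v.1, (1/2 : ℝ) • v.2.1, (1 : ℝ) • v.2.2) = (1/2) ^ 2 * KK n v := by
      simp only [KK, Pi.smul_apply, smul_eq_mul, mul_pow, ← Finset.mul_sum]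
      ring
    simp only [fK]
    rw [e, Real.mul_rpow (by norm_num) p2.le, Real.mul_rpow (by norm_num) p1.le, half_nat]
    push_cast
    ring
  · have e1 : (1/2 : ℝ) * (1/2) ^ n * 1 ^ n = (1/2 : ℝ) ^ ((n : ℝ) + 1) := by
      rw [Real.rpow_add (by norm_num), Real.rpow_one, Real.rpow_natCast]
      ring
    rw [e1, ← Real.rpow_add (by norm_num), ← Real.rpow_add (by norm_num)]
    congr 1
    ring

lemma step2 (n : ℕ) (hn : 0 < n) (ε : ℝ) (hε : 0 < ε) (α z : ℝ) :
    ∫⁻ v in T2 n ε 0, ENNReal.ofReal (fK n α z v) =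
      (∫⁻ v in T2 n ε 0 \ T2 n ε 1, ENNReal.ofReal (fK n α z v)) *
        (1 - ENNReal.ofReal ((1/2 : ℝ) ^ (4 * (z + 3 * n / 4))))⁻¹ := by
  refine geom_fK n α z 1 (1/4) (1/2) ((1/2 : ℝ) ^ (4 * z)) _ (by norm_num) (by norm_num)
    (by norm_num) (by positivity) _ (anti_T2 n ε hε) (meas_T2 n ε) (inter_T2 n hn ε hε) (scale_T2 n ε) ?_ ?_
  · intro v hv
    obtain ⟨p1, p2⟩ := pos_T1 n hn ε v (T2_sub n ε hε 0 hv)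
    have e : KK n ((1 : ℝ) * v.1, (1/4 : ℝ) • v.2.1, (1/2 : ℝ) • v.2.2) = (1/2) ^ 4 * KK n v := by
      simp only [KK, Pi.smul_apply, smul_eq_mul, mul_pow, ← Finset.mul_sum]
      ring
    simp only [fK]
    rw [e, Real.mul_rpow (by norm_num) p2.le, half_nat]
    push_cast
    rw [one_mul]
    ring
  · have e1 : (1 : ℝ) * (1/4) ^ n * (1/2) ^ n = (1/2 : ℝ) ^ (3 * (n : ℝ)) := by
      have : (3 * (n : ℝ)) = ((3 * n : ℕ) : ℝ) := by push_cast; ring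
      rw [this, Real.rpow_natCast, pow_mul, one_mul, ← mul_pow]
      norm_num
    rw [e1, ← Real.rpow_add (by norm_num)]
    congr 1
    ring

lemma vol_R2 (n : ℕ) (hn : 0 < n) (ε : ℝ) (hε : 0 < ε) : volume (T2 n ε 0 \ T2 n ε 1) ≠ 0 := by
  have hsub : Set.Ioc (ε / 2) ε ×ˢ (cubeK n ε ×ˢ Set.pi Set.univ (fun _ : Fin n => Set.Ioc (ε/2) ε)) ⊆
      T2 n ε 0 \ T2 n ε 1 := by
    rintro v ⟨h1, h2, h3⟩
    simp only [Set.mem_pi, Set.mem_univ, true_imp_iff, Set.mem_Ioc] at h3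
    refine ⟨⟨h1, by simpa using h2, ?_⟩, ?_⟩
    · rw [mem_cubeK]
      intro i
      have := h3 i
      rw [pow_zero, mul_one]
      constructor <;> linarith
    · rintro ⟨-, -, h4⟩
      have := (mem_cubeK.1 h4 ⟨0, hn⟩).2
      have := (h3 ⟨0, hn⟩).1
      linarith
  intro h
  have := measure_mono_null hsub h
  rw [Measure.volume_eq_prod, Measure.prod_prod, Measure.volume_eq_prod, Measure.prod_prod, volume_cubeK, Real.volume_pi_Ioc] at this
  simp only [mul_eq_zero, Real.volume_Ioc, Finset.prod_const] at this
  have e : 0 < ENNReal.ofReal (ε - ε / 2) := by simp [hε]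
  have e' : 0 < ENNReal.ofReal ε := by simp [hε]
  rcases this with h | h | h
  · exact e.ne' h
  · exact (pow_ne_zero _ e'.ne') h
  · exact (pow_ne_zero _ e.ne') h

lemma formula (n : ℕ) (hn : 0 < n) (ε : ℝ) (hε : 0 < ε) (α : ℝ) (hα : 0 < α) :
    ∃ r1 r2 : ℝ → ℝ, Continuous r1 ∧ Continuous r2 ∧ (∀ z, 0 ≤ r1 z) ∧ (∀ z, 0 < r2 z) ∧
      ∀ z, ∫⁻ v in T1 n ε 0, ENNReal.ofReal (fK n α z v) =
        (ENNReal.ofReal (r2 z) * (1 - ENNReal.ofReal ((1/2 : ℝ) ^ (4 * (z + 3 * n / 4))))⁻¹ + ENNReal.ofReal (r1 z)) *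
        (1 - ENNReal.ofReal ((1/2 : ℝ) ^ (2 * (z + (n + α) / 2))))⁻¹ := by
  obtain ⟨r1, a1, a2, -, a3⟩ := region n hn ε hε α hα (R1 n ε) (meas_R1 n ε) (R1_sub n ε hε) ((ε/2)^2) (by positivity) (by
    rintro v ⟨-, h2, -⟩
    obtain ⟨i, hi⟩ := notMem_cubeK h2.1 h2.2
    exact KK_ge_delta n _ (by positivity) v i hi)
  obtain ⟨r2, b1, -, b2, b3⟩ := region n hn ε hε α hα (T2 n ε 0 \ T2 n ε 1) ((meas_T2 n ε 0).diff (meas_T2 n ε 1))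
    (Set.sdiff_subset.trans (T2_sub n ε hε 0)) (min ((ε/4)^2) ((ε/2)^2 * (ε/2)^4)) (by positivity) (by
    rintro v ⟨⟨h1, h2, h3⟩, h4⟩
    have : v.2.1 ∉ cubeK n (ε/4) ∨ v.2.2 ∉ cubeK n (ε/2) := by
      by_contra! hcon
      apply h4
      refine ⟨h1, ?_, ?_⟩
      · convert hcon.1 using 1; ring_nf
      · convert hcon.2 using 1; ring_nf
    rcases this with h | h
    · obtain ⟨i, hi⟩ := notMem_cubeK h2 h
      exact (min_le_left _ _).trans (KK_ge_delta n _ (by positivity) v i hi)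
    · obtain ⟨i, hi⟩ := notMem_cubeK h3 h
      exact (min_le_right _ _).trans (KK_ge_beta n _ _ (by positivity) (by positivity) v i hi h1.1))
  refine ⟨r1, r2, a1, b1, a2, b2 (vol_R2 n hn ε hε), fun z => ?_⟩
  rw [step1 n hn ε hε, step2 n hn ε hε, a3, b3]

lemma lim_half (k p lam : ℝ) (h : 0 < k * (-lam + p)) :
    Tendsto (fun z : ℝ => (1 - (1/2:ℝ) ^ (k * (z + p)))⁻¹) (nhdsWithin (-lam) (Set.Ioi (-lam)))
      (nhds (1 - (1/2:ℝ) ^ (k * (-lam + p)))⁻¹) ∧ 0 < (1 - (1/2:ℝ) ^ (k * (-lam + p)))⁻¹ := by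
  have h1 : (1/2:ℝ) ^ (k * (-lam + p)) < 1 := Real.rpow_lt_one (by norm_num) (by norm_num) h
  have h2 : 0 < 1 - (1/2:ℝ) ^ (k * (-lam + p)) := by linarith
  refine ⟨Tendsto.inv₀ ?_ h2.ne', by positivity⟩
  have : Continuous (fun z : ℝ => 1 - (1/2:ℝ) ^ (k * (z + p))) := by
    refine continuous_const.sub (Continuous.rpow continuous_const (by fun_prop) fun _ => Or.inl (by norm_num))
  exact this.continuousAt.tendsto.mono_left nhdsWithin_le_nhds

theorem lim_main (r1 r2 : ℝ → ℝ) (h1 : Continuous r1) (h2 : Continuous r2) (p1 : ∀ z, 0 ≤ r1 z)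
    (p2 : ∀ z, 0 < r2 z) (p q : ℝ) (m : ℕ) (hm : m = if p = q then 2 else 1) :
    ∃ C : ℝ, 0 < C ∧ Tendsto (fun z : ℝ => (z + min p q) ^ m *
      ((r2 z * (1 - (1/2:ℝ) ^ (4 * (z + q)))⁻¹ + r1 z) * (1 - (1/2:ℝ) ^ (2 * (z + p)))⁻¹))
      (nhdsWithin (-(min p q)) (Set.Ioi (-(min p q)))) (nhds C) := by
  have hl : 0 < Real.log 2 := Real.log_pos (by norm_num)
  have t1 : ∀ l, Tendsto r1 (nhdsWithin l (Set.Ioi l)) (nhds (r1 l)) := fun l =>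
    h1.continuousAt.tendsto.mono_left nhdsWithin_le_nhds
  have t2 : ∀ l, Tendsto r2 (nhdsWithin l (Set.Ioi l)) (nhds (r2 l)) := fun l =>
    h2.continuousAt.tendsto.mono_left nhdsWithin_le_nhds
  have t3 : ∀ l, Tendsto (fun z : ℝ => z + l) (nhdsWithin (-l) (Set.Ioi (-l))) (nhds 0) := fun l => by
    have : Continuous fun z : ℝ => z + l := by fun_prop
    have h := this.continuousAt (x := -l) |>.tendsto.mono_left (nhdsWithin_le_nhds (s := Set.Ioi (-l)))
    simpa using h
  rcases lt_trichotomy p q with h | h | h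
  · rw [if_neg h.ne] at hm
    subst hm
    rw [min_eq_left h.le]
    obtain ⟨l1, l2⟩ := lim_half 4 q p (by linarith)
    have l3 := lim_aux 2 (by norm_num) p
    have := (((t2 (-p)).mul l1).add (t1 (-p))).mul l3
    refine ⟨_, ?_, this.congr fun z => by rw [div_eq_mul_inv]; ring⟩
    have := p1 (-p)
    have := p2 (-p)
    positivity
  · rw [if_pos h] at hm
    subst hm h
    rw [min_self]
    have l3 := lim_aux 2 (by norm_num) p
    have l4 := lim_aux 4 (by norm_num) p
    have := (((t2 (-p)).mul l4).add ((t1 (-p)).mul (t3 p))).mul l3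
    refine ⟨_, ?_, this.congr fun z => by rw [div_eq_mul_inv, div_eq_mul_inv]; ring⟩
    have := p2 (-p)
    rw [mul_zero, add_zero]
    positivity
  · rw [if_neg h.ne'] at hm
    subst hm
    rw [min_eq_right h.le]
    obtain ⟨l1, l2⟩ := lim_half 2 p q (by linarith)
    have l3 := lim_aux 4 (by norm_num) q
    have := (((t2 (-q)).mul l3).add ((t1 (-q)).mul (t3 q))).mul l1
    refine ⟨_, ?_, this.congr fun z => by rw [div_eq_mul_inv]; ring⟩
    have := p2 (-q)
    rw [mul_zero, add_zero]
    positivity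

lemma ennreal_half (x : ℝ) (hx : 0 < x) : (1 - ENNReal.ofReal ((1/2:ℝ) ^ x))⁻¹ = ENNReal.ofReal ((1 - (1/2:ℝ) ^ x)⁻¹)
    ∧ 0 < (1 - (1/2:ℝ) ^ x)⁻¹ := by
  have h1 : (1/2:ℝ) ^ x < 1 := Real.rpow_lt_one (by norm_num) (by norm_num) hx
  have h2 : 0 < 1 - (1/2:ℝ) ^ x := by linarith
  refine ⟨?_, by positivity⟩
  rw [ENNReal.ofReal_inv_of_pos h2, ENNReal.ofReal_sub _ (by positivity), ENNReal.ofReal_one]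

lemma ennreal_half_top (x : ℝ) (hx : x ≤ 0) : (1 - ENNReal.ofReal ((1/2:ℝ) ^ x))⁻¹ = ⊤ := by
  have h1 : 1 ≤ (1/2:ℝ) ^ x := Real.one_le_rpow_of_pos_of_le_one_of_nonpos (by norm_num) (by norm_num) hx
  rw [ENNReal.inv_eq_top, tsub_eq_zero_iff_le]
  exact ENNReal.one_le_ofReal.2 h1

lemma box_ae (n : ℕ) (ε : ℝ) :
    ({v | v.1 ∈ Set.Icc 0 ε ∧ (∀ ℓ, v.2.1 ℓ ∈ Set.Icc 0 ε) ∧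
            (∀ ℓ, v.2.2 ℓ ∈ Set.Icc 0 ε)} : Set (ℝ × (Fin n → ℝ) × (Fin n → ℝ))) =ᵐ[volume] T1 n ε 0 := by
  have e : ({v | v.1 ∈ Set.Icc 0 ε ∧ (∀ ℓ, v.2.1 ℓ ∈ Set.Icc 0 ε) ∧
            (∀ ℓ, v.2.2 ℓ ∈ Set.Icc 0 ε)} : Set (ℝ × (Fin n → ℝ) × (Fin n → ℝ))) =
      Set.Icc 0 ε ×ˢ (Set.pi Set.univ (fun _ => Set.Icc 0 ε) ×ˢ Set.pi Set.univ (fun _ => Set.Icc 0 ε)) := by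
    ext v
    simp only [Set.mem_prod, Set.mem_ofPred_eq, Set.mem_pi, Set.mem_univ, true_imp_iff]
  have hp : cubeK n ε =ᵐ[volume] (Set.pi Set.univ (fun _ => Set.Icc 0 ε)) := Measure.pi_Ioc_ae_eq_pi_Icc
  rw [e]
  simp only [T1, pow_zero, mul_one]
  exact Measure.set_prod_ae_eq Ioc_ae_eq_Icc.symm (Measure.set_prod_ae_eq hp.symm hp.symm)

theorem core (n : ℕ) (hn : 0 < n) (ε : ℝ) (hε : 0 < ε) (α : ℝ) (hα : 0 < α) (m : ℕ)
    (hm : m = if ((n : ℝ) + α) / 2 = 3 * n / 4 then 2 else 1)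
    (S : Set (ℝ × (Fin n → ℝ) × (Fin n → ℝ))) (hS : S =ᵐ[volume] T1 n ε 0) (lam : ℝ)
    (hlam : lam = min (((n : ℝ) + α) / 2) (3 * n / 4)) :
    (∀ z : ℝ, -lam < z → IntegrableOn (fK n α z) S volume) ∧
    (∀ z : ℝ, z ≤ -lam → ¬ IntegrableOn (fK n α z) S volume) ∧
    ∃ C : ℝ, 0 < C ∧
      Tendsto (fun z : ℝ => (z + lam) ^ m * ∫ v in S, fK n α z v ∂volume)
        (nhdsWithin (-lam) (Set.Ioi (-lam))) (nhds C) := by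
  obtain ⟨r1, r2, c1, c2, p1, p2, hF⟩ := formula n hn ε hε α hα
  have hnn : ∀ z, 0 ≤ᵐ[volume.restrict (T1 n ε 0)] fK n α z := fun z =>
    (ae_restrict_iff' (meas_T1 n ε 0)).2 (Eventually.of_forall fun v hv => by
      obtain ⟨q1, q2⟩ := pos_T1 n hn ε v hv
      simp only [Pi.zero_apply, fK]
      positivity)
  have hII : ∀ z, IntegrableOn (fK n α z) S volume ↔
      ∫⁻ v in T1 n ε 0, ENNReal.ofReal (fK n α z v) < ⊤ := by
    intro z
    rw [integrableOn_congr_set_ae hS, IntegrableOn, Integrable, hasFiniteIntegral_iff_ofReal (hnn z)]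
    exact and_iff_right (meas_fK n α z).aestronglyMeasurable
  have hval : ∀ z, -lam < z → ∫⁻ v in T1 n ε 0, ENNReal.ofReal (fK n α z v) =
      ENNReal.ofReal ((r2 z * (1 - (1/2:ℝ) ^ (4 * (z + 3 * n / 4)))⁻¹ + r1 z) * (1 - (1/2:ℝ) ^ (2 * (z + (n + α) / 2)))⁻¹)
      ∧ 0 ≤ ((r2 z * (1 - (1/2:ℝ) ^ (4 * (z + 3 * n / 4)))⁻¹ + r1 z) * (1 - (1/2:ℝ) ^ (2 * (z + (n + α) / 2)))⁻¹) := by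
    intro z hz
    have m1 := min_le_left (((n : ℝ) + α) / 2) (3 * n / 4)
    have m2 := min_le_right (((n : ℝ) + α) / 2) (3 * n / 4)
    rw [← hlam] at m1 m2
    obtain ⟨e1, e2⟩ := ennreal_half (4 * (z + 3 * n / 4)) (by linarith)
    obtain ⟨e3, e4⟩ := ennreal_half (2 * (z + (n + α) / 2)) (by linarith)
    have q1 := p1 z
    have q2 := p2 z
    refine ⟨?_, by positivity⟩
    rw [hF, e1, e3, ENNReal.ofReal_mul (by positivity), ENNReal.ofReal_add (by positivity) q1,
      ENNReal.ofReal_mul q2.le]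
  refine ⟨?_, ?_, ?_⟩
  · intro z hz
    rw [hII, (hval z hz).1]
    exact ENNReal.ofReal_lt_top
  · intro z hz
    rw [hII, hF, not_lt, top_le_iff]
    have q2 : ENNReal.ofReal (r2 z) ≠ 0 := (ENNReal.ofReal_pos.2 (p2 z)).ne'
    have i1 : ∀ x : ℝ, (1 - ENNReal.ofReal x)⁻¹ ≠ 0 := fun x =>
      ENNReal.inv_ne_zero.2 (ne_top_of_le_ne_top ENNReal.one_ne_top tsub_le_self)
    rcases min_choice (((n : ℝ) + α) / 2) (3 * n / 4) with h | h <;> rw [h] at hlam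
    · rw [ennreal_half_top (2 * (z + (n + α) / 2)) (by linarith), ENNReal.mul_top]
      simp [q2, i1]
    · rw [ennreal_half_top (4 * (z + 3 * n / 4)) (by linarith), ENNReal.mul_top q2, top_add, ENNReal.top_mul (i1 _)]
  · obtain ⟨C, hC, hlim⟩ := lim_main r1 r2 c1 c2 p1 p2 (((n : ℝ) + α) / 2) (3 * n / 4) m hm
    rw [← hlam] at hlim
    refine ⟨C, hC, hlim.congr' ?_⟩
    filter_upwards [self_mem_nhdsWithin] with z hz
    rw [setIntegral_congr_set hS, integral_eq_lintegral_of_nonneg_ae (hnn z) (meas_fK n α z).aestronglyMeasurable,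
      (hval z hz).1, ENNReal.toReal_ofReal (hval z hz).2]



/-- RLCT of `K₃(v) = Σ δ_ℓ^2 + a^2 Σ β_ℓ^4` over a small box with
Dirichlet-type prior factor `a^{α−1}`: `ζ(z) = ∫ K₃(v)^z a^{α−1} dv` converges
exactly for `z > −λ` with `λ = (L−1)/2 + min(α/2, (L−1)/4)`, and has largest pole
at `z = −λ` of order `2` if `α = (L−1)/2` and `1` otherwise. -/
theorem rlct_K3_dirichlet_prior (L : ℕ) (hL : 2 ≤ L) (ε : ℝ) (hε : 0 < ε)
    (α : ℝ) (hα : 0 < α) :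
    ∀ lam : ℝ, lam = ((L : ℝ) - 1) / 2 + min (α / 2) (((L : ℝ) - 1) / 4) →
    ∀ m : ℕ, m = (if α = ((L : ℝ) - 1) / 2 then 2 else 1) →
    ∀ S : Set (ℝ × (Fin (L - 1) → ℝ) × (Fin (L - 1) → ℝ)),
      S = {v | v.1 ∈ Set.Icc 0 ε ∧ (∀ ℓ, v.2.1 ℓ ∈ Set.Icc 0 ε) ∧
            (∀ ℓ, v.2.2 ℓ ∈ Set.Icc 0 ε)} →
    ∀ K3 : ℝ × (Fin (L - 1) → ℝ) × (Fin (L - 1) → ℝ) → ℝ,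
      K3 = (fun v => ∑ ℓ, v.2.1 ℓ ^ 2 + v.1 ^ 2 * ∑ ℓ, v.2.2 ℓ ^ 4) →
    (∀ z : ℝ, -lam < z →
      IntegrableOn (fun v => K3 v ^ z * v.1 ^ (α - 1)) S volume) ∧
    (∀ z : ℝ, z ≤ -lam →
      ¬ IntegrableOn (fun v => K3 v ^ z * v.1 ^ (α - 1)) S volume) ∧
    ∃ C : ℝ, 0 < C ∧
      Tendsto (fun z : ℝ =>
          (z + lam) ^ m * ∫ v in S, K3 v ^ z * v.1 ^ (α - 1) ∂volume)
        (nhdsWithin (-lam) (Set.Ioi (-lam))) (nhds C) := by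
  have hn : 0 < L - 1 := by omega
  have hc : ((L - 1 : ℕ) : ℝ) = (L : ℝ) - 1 := by
    rw [Nat.cast_sub (by omega), Nat.cast_one]
  rintro lam hlam m hm S rfl K3 rfl
  refine core (L - 1) hn ε hε α hα m ?_ _ (box_ae _ ε) lam ?_
  · rw [hm, hc]
    refine if_congr ?_ rfl rfl
    constructor <;> intro h <;> linarith
  · rw [hlam, hc, ← min_add_add_left]
    congr 1 <;> ring
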